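/- arXiv:2011.00520 — 10 statements merged into one kernel-verified Lean document; each statement's English description precedes it below -/
import Mathlib

section
/- Let T and T* be n×n real symmetric matrices such that T*_{ij} ≤ T_{ij} for all i ≠ j and such that T and T* have the same row sums (equivalently, T*_{ii} − T_{ii} = Σ_{j≠i} (T_{ij} − T*_{ij}) for every i). Then for every k ∈ {1,…,n}, λ_k(T*) ≥ λ_k(T), i.e. every ordered eigenvalue of T* is at least the corresponding ordered eigenvalue of T. -/
/-- The eigenvalues of a real symmetric (Hermitian) matrix, listed in
decreasing order with multiplicity: `sortedEigenvalues hA 0 ≥ sortedEigenvalues hA 1 ≥ …`. -/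
noncomputable def sortedEigenvalues {n : ℕ} {A : Matrix (Fin n) (Fin n) ℝ}
    (hA : A.IsHermitian) : Fin n → ℝ :=
  fun k => (hA.eigenvalues ∘ Tuple.sort hA.eigenvalues) k.rev

open scoped InnerProductSpace

/-- The quadratic form of a symmetric operator in an orthonormal eigenbasis. -/
theorem LinearMap.IsSymmetric.inner_apply_self_eq_sum {ι E : Type*} [Fintype ι]
    [NormedAddCommGroup E] [InnerProductSpace ℝ E] {S : E →ₗ[ℝ] E} (hS : S.IsSymmetric)
    (b : OrthonormalBasis ι ℝ E) {μ : ι → ℝ} (hb : ∀ i, S (b i) = μ i • b i) (x : E) :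
    ⟪S x, x⟫_ℝ = ∑ i, μ i * ⟪b i, x⟫_ℝ ^ 2 := by
  rw [← b.sum_inner_mul_inner]
  refine Finset.sum_congr rfl fun i _ => ?_
  rw [hS, hb, real_inner_smul_right, real_inner_comm]
  ring

/-- **Weyl monotonicity**: if the quadratic form of `S` is dominated by that of `S'`, then so are
the eigenvalues, listed in decreasing order. -/
theorem LinearMap.IsSymmetric.eigenvalue_le_of_inner_le {n : ℕ} {E : Type*}
    [NormedAddCommGroup E] [InnerProductSpace ℝ E] {S S' : E →ₗ[ℝ] E}
    (hS : S.IsSymmetric) (hS' : S'.IsSymmetric) (b c : OrthonormalBasis (Fin n) ℝ E)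
    {μ ν : Fin n → ℝ} (hb : ∀ i, S (b i) = μ i • b i) (hc : ∀ i, S' (c i) = ν i • c i)
    (hμ : Antitone μ) (hν : Antitone ν) (hle : ∀ x, ⟪S x, x⟫_ℝ ≤ ⟪S' x, x⟫_ℝ) (k : Fin n) :
    μ k ≤ ν k := by
  have : FiniteDimensional ℝ E := b.toBasis.finiteDimensional_of_finite
  let f : E →ₗ[ℝ] ({i : Fin n // i ≠ k} → ℝ) :=
    LinearMap.pi fun i => innerₗ E (if (i : Fin n) < k then c i else b i)
  have hdim : Module.finrank ℝ ({i : Fin n // i ≠ k} → ℝ) < Module.finrank ℝ E := by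
    rw [Module.finrank_fintype_fun_eq_card, Module.finrank_eq_card_basis b.toBasis]
    exact Fintype.card_subtype_lt (x := k) (by simp)
  obtain ⟨x, hx, hx0⟩ :=
    (Submodule.ne_bot_iff _).1 (LinearMap.ker_ne_bot_of_finrank_lt (f := f) hdim)
  have hf : ∀ i : Fin n, i ≠ k → ⟪if i < k then c i else b i, x⟫_ℝ = 0 := fun i hi =>
    congrFun (LinearMap.mem_ker.1 hx) ⟨i, hi⟩
  have hlow : μ k * ‖x‖ ^ 2 ≤ ⟪S x, x⟫_ℝ := by
    rw [hS.inner_apply_self_eq_sum b hb, ← b.sum_sq_inner_right, Finset.mul_sum]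
    refine Finset.sum_le_sum fun i _ => ?_
    rcases le_or_gt i k with h | h
    · exact mul_le_mul_of_nonneg_right (hμ h) (sq_nonneg _)
    · have := hf i h.ne'
      rw [if_neg h.not_gt] at this
      simp [this]
  have hupp : ⟪S' x, x⟫_ℝ ≤ ν k * ‖x‖ ^ 2 := by
    rw [hS'.inner_apply_self_eq_sum c hc, ← c.sum_sq_inner_right, Finset.mul_sum]
    refine Finset.sum_le_sum fun i _ => ?_
    rcases le_or_gt k i with h | h
    · exact mul_le_mul_of_nonneg_right (hν h) (sq_nonneg _)
    · have := hf i h.ne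
      rw [if_pos h] at this
      simp [this]
  exact le_of_mul_le_mul_right (hlow.trans ((hle x).trans hupp)) (by positivity)

/-- A symmetric real matrix with zero row sums and nonpositive off-diagonal entries has a
nonnegative quadratic form. -/
theorem Matrix.dotProduct_mulVec_nonneg_of_sum_row_eq_zero {ι : Type*} [Fintype ι]
    {D : Matrix ι ι ℝ} (hD : D.IsSymm) (hoff : ∀ i j, i ≠ j → D i j ≤ 0)
    (hrow : ∀ i, ∑ j, D i j = 0) (x : ι → ℝ) : 0 ≤ x ⬝ᵥ D.mulVec x := by
  have hleft : ∑ i, ∑ j, D i j * x i ^ 2 = 0 := by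
    simp [← Finset.sum_mul, hrow]
  have hright : ∑ i, ∑ j, D i j * x j ^ 2 = 0 := by
    rw [Finset.sum_comm, ← hleft]
    exact Finset.sum_congr rfl fun i _ => Finset.sum_congr rfl fun j _ => by rw [hD.apply]
  have hsq : ∑ i, ∑ j, D i j * (x i - x j) ^ 2 = -2 * (x ⬝ᵥ D.mulVec x) := by
    calc ∑ i, ∑ j, D i j * (x i - x j) ^ 2
        = ∑ i, ∑ j, (D i j * x i ^ 2 + D i j * x j ^ 2 + -2 * (x i * (D i j * x j))) := by
          refine Finset.sum_congr rfl fun i _ => Finset.sum_congr rfl fun j _ => ?_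
          ring
      _ = -2 * (x ⬝ᵥ D.mulVec x) := by
          simp only [Finset.sum_add_distrib, hleft, hright, ← Finset.mul_sum, dotProduct, mulVec]
          ring
  have hnonpos : ∑ i, ∑ j, D i j * (x i - x j) ^ 2 ≤ 0 := by
    refine Finset.sum_nonpos fun i _ => Finset.sum_nonpos fun j _ => ?_
    rcases eq_or_ne i j with rfl | h
    · simp
    · exact mul_nonpos_of_nonpos_of_nonneg (hoff i j h) (sq_nonneg _)
  linarith

theorem sortedEigenvalues_antitone {n : ℕ} {A : Matrix (Fin n) (Fin n) ℝ} (hA : A.IsHermitian) :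
    Antitone (sortedEigenvalues hA) := fun _ _ h =>
  Tuple.monotone_sort hA.eigenvalues (Fin.rev_le_rev.2 h)

/-- An orthonormal eigenbasis listed in the order of `sortedEigenvalues`. -/
theorem exists_orthonormalBasis_sortedEigenvalues {n : ℕ} {A : Matrix (Fin n) (Fin n) ℝ}
    (hA : A.IsHermitian) : ∃ b : OrthonormalBasis (Fin n) ℝ (EuclideanSpace ℝ (Fin n)),
      ∀ i, Matrix.toEuclideanLin A (b i) = sortedEigenvalues hA i • b i := by
  refine ⟨hA.eigenvectorBasis.reindex (Fin.revPerm.trans (Tuple.sort hA.eigenvalues)).symm,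
    fun i => ?_⟩
  ext j
  simpa [sortedEigenvalues, Matrix.toLpLin_apply] using
    congrFun (hA.mulVec_eigenvectorBasis (Tuple.sort hA.eigenvalues i.rev)) j

/-- Transferring weight from off-diagonal entries to the diagonal of a real symmetric
matrix (keeping row sums fixed) weakly increases every ordered eigenvalue. -/
theorem eigenvalues_mono_of_weight_transfer {n : ℕ}
    (T Tstar : Matrix (Fin n) (Fin n) ℝ)
    (hT : T.IsHermitian) (hTstar : Tstar.IsHermitian)
    (hoff : ∀ i j, i ≠ j → Tstar i j ≤ T i j)
    (hrow : ∀ i, ∑ j, Tstar i j = ∑ j, T i j) :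
    ∀ k : Fin n, sortedEigenvalues hT k ≤ sortedEigenvalues hTstar k := by
  obtain ⟨b, hb⟩ := exists_orthonormalBasis_sortedEigenvalues hT
  obtain ⟨c, hc⟩ := exists_orthonormalBasis_sortedEigenvalues hTstar
  refine LinearMap.IsSymmetric.eigenvalue_le_of_inner_le
    (Matrix.isSymmetric_toEuclideanLin_iff.2 hT) (Matrix.isSymmetric_toEuclideanLin_iff.2 hTstar)
    b c hb hc (sortedEigenvalues_antitone hT) (sortedEigenvalues_antitone hTstar) fun x => ?_
  have hD : 0 ≤ x.ofLp ⬝ᵥ (Tstar - T).mulVec x.ofLp :=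
    Matrix.dotProduct_mulVec_nonneg_of_sum_row_eq_zero (hTstar.sub hT)
      (fun i j h => sub_nonpos.2 (hoff i j h)) (fun i => by simp [hrow]) x.ofLp
  rw [Matrix.sub_mulVec, dotProduct_sub, sub_nonneg] at hD
  simpa [EuclideanSpace.inner_eq_star_dotProduct, Matrix.toLpLin_apply] using hD
end

section
/- Let T and T* be n×n real symmetric row-stochastic matrices (all entries nonnegative, rows summing to 1) such that: T_{ii} ≥ 1/2 for every i; T*_{ij} ≤ T_{ij} for all i ≠ j; T and T* have the same row sums (so T*_{ii} ≥ T_{ii} ≥ 1/2); and both T and T* are irreducible. For ε > 0 define the average convergence time τ_ε(S) = min{ t ≥ 1 : (1/n) Σ_{i=1}^n ‖(S^t)_{i,·} − (1/n,…,1/n)‖₂² < ε } = min{ t ≥ 1 : (1/n)(trace(S^{2t}) − 1) < ε }. Then for every t ≥ 1, trace((T*)^{2t}) ≥ trace(T^{2t}), and consequently τ_ε(T*) ≥ τ_ε(T) for every ε > 0 (both minima being attained, i.e. finite, by irreducibility and aperiodicity). -/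
/-- A matrix is row-stochastic if all its entries are nonnegative and each row sums to 1. -/
def RowStochastic {n : ℕ} (T : Matrix (Fin n) (Fin n) ℝ) : Prop :=
  (∀ i j, 0 ≤ T i j) ∧ ∀ i, ∑ j, T i j = 1

/-- A matrix is irreducible if its associated directed graph is strongly connected:
for all `i j` there is some `k ≥ 1` with `(T^k) i j > 0`. -/
def MatIrreducible {n : ℕ} (T : Matrix (Fin n) (Fin n) ℝ) : Prop :=
  ∀ i j, ∃ k : ℕ, 0 < k ∧ 0 < (T ^ k) i j

/-- The set of times `t ≥ 1` at which the average squared `ℓ₂`-distance of the rows of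
`S^t` from the uniform stationary distribution `(1/n, …, 1/n)` is below `ε`. -/
def convSet {n : ℕ} (S : Matrix (Fin n) (Fin n) ℝ) (ε : ℝ) : Set ℕ :=
  {t : ℕ | 1 ≤ t ∧ (1 / (n : ℝ)) * ∑ i, ∑ j, ((S ^ t) i j - 1 / (n : ℝ)) ^ 2 < ε}

/-- The average convergence time: the least `t ≥ 1` at which the average squared
distance to stationarity drops below `ε`. -/
noncomputable def convTime {n : ℕ} (S : Matrix (Fin n) (Fin n) ℝ) (ε : ℝ) : ℕ :=
  sInf (convSet S ε)

open Matrix Finset Filter Topology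

section Spectral

variable {ι : Type*} [Fintype ι] [DecidableEq ι]

/-- Powers of a real symmetric matrix in terms of an orthogonal diagonalization. -/
theorem Matrix.IsHermitian.exists_orthogonal_pow_eq {A : Matrix ι ι ℝ} (hA : A.IsHermitian) :
    ∃ U : Matrix ι ι ℝ, U * Uᵀ = 1 ∧ Uᵀ * U = 1 ∧
      ∀ m : ℕ, A ^ m = U * diagonal (fun i => hA.eigenvalues i ^ m) * Uᵀ := by
  have hU := hA.eigenvectorUnitary.2
  have h1 : (hA.eigenvectorUnitary : Matrix ι ι ℝ) *
      (hA.eigenvectorUnitary : Matrix ι ι ℝ)ᵀ = 1 := by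
    simpa [star_eq_conjTranspose] using (Unitary.mem_iff.mp hU).2
  have h2 : (hA.eigenvectorUnitary : Matrix ι ι ℝ)ᵀ *
      (hA.eigenvectorUnitary : Matrix ι ι ℝ) = 1 := by
    simpa [star_eq_conjTranspose] using (Unitary.mem_iff.mp hU).1
  have hspec : A = (hA.eigenvectorUnitary : Matrix ι ι ℝ) * diagonal hA.eigenvalues *
      (hA.eigenvectorUnitary : Matrix ι ι ℝ)ᵀ := by
    have h := hA.spectral_theorem
    rw [Unitary.conjStarAlgAut_apply] at h
    simpa [star_eq_conjTranspose, Function.comp_def] using h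
  refine ⟨hA.eigenvectorUnitary, h1, h2, fun m => ?_⟩
  generalize (hA.eigenvectorUnitary : Matrix ι ι ℝ) = U at *
  generalize hA.eigenvalues = d at *
  induction m with
  | zero => simp [h1]
  | succ m ih =>
    calc A ^ (m + 1) = A ^ m * A := pow_succ A m
      _ = U * diagonal (fun i => d i ^ m) * Uᵀ * (U * diagonal d * Uᵀ) := by rw [ih, ← hspec]
      _ = U * diagonal (fun i => d i ^ m) * (Uᵀ * U) * diagonal d * Uᵀ := by
        simp only [Matrix.mul_assoc]
      _ = U * (diagonal (fun i => d i ^ m) * diagonal d) * Uᵀ := by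
        rw [h2, Matrix.mul_one]; simp only [Matrix.mul_assoc]
      _ = _ := by rw [diagonal_mul_diagonal]; simp only [pow_succ]

/-- Jensen's inequality for the diagonal entries of powers of a positive semidefinite matrix. -/
theorem Matrix.PosSemidef.diag_pow_le_pow_diag {M : Matrix ι ι ℝ} (hM : M.PosSemidef)
    (m : ℕ) (i : ι) : M i i ^ m ≤ (M ^ m) i i := by
  obtain ⟨U, hU, -, hpow⟩ := hM.1.exists_orthogonal_pow_eq
  have entry (k : ℕ) : (M ^ k) i i = ∑ j, U i j ^ 2 * hM.1.eigenvalues j ^ k := by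
    rw [hpow k, mul_apply]
    refine sum_congr rfl fun j _ => ?_
    rw [mul_diagonal, transpose_apply]
    ring
  have hweights : ∑ j, U i j ^ 2 = 1 := by
    simpa [mul_apply, sq] using congrFun (congrFun hU i) i
  have hMi : M i i = ∑ j, U i j ^ 2 * hM.1.eigenvalues j := by simpa using entry 1
  rw [hMi, entry]
  exact Real.pow_arith_mean_le_arith_mean_pow _ _ _ (fun _ _ => sq_nonneg _) hweights
    (fun j _ => hM.eigenvalues_nonneg j) m

/-- Traces of powers are monotone for the Loewner order on positive semidefinite matrices. -/
theorem Matrix.PosSemidef.trace_pow_le_trace_pow {A B : Matrix ι ι ℝ} (hA : A.PosSemidef)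
    (hAB : (B - A).PosSemidef) (m : ℕ) : (A ^ m).trace ≤ (B ^ m).trace := by
  obtain ⟨U, hU, hU', hpow⟩ := hA.1.exists_orthogonal_pow_eq
  have hB : B.PosSemidef := by simpa using hA.add hAB
  have conj_pow (k : ℕ) : (Uᵀ * B * U) ^ k = Uᵀ * B ^ k * U := by
    induction k with
    | zero => simp [hU']
    | succ k ih =>
      calc (Uᵀ * B * U) ^ (k + 1) = Uᵀ * B ^ k * (U * Uᵀ) * B * U := by
            rw [pow_succ, ih]; simp only [Matrix.mul_assoc]
        _ = _ := by rw [hU, Matrix.mul_one, pow_succ]; simp only [Matrix.mul_assoc]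
  have trace_conj (X : Matrix ι ι ℝ) : (Uᵀ * X * U).trace = X.trace := by
    rw [trace_mul_comm, ← Matrix.mul_assoc, hU, Matrix.one_mul]
  have hdiagA : Uᵀ * A * U = diagonal hA.1.eigenvalues := by
    have h := hpow 1
    simp only [pow_one] at h
    calc Uᵀ * A * U = Uᵀ * U * diagonal hA.1.eigenvalues * (Uᵀ * U) := by
          conv_lhs => rw [h]
          simp only [Matrix.mul_assoc]
      _ = _ := by rw [hU', Matrix.one_mul, Matrix.mul_one]
  have hle (i : ι) : hA.1.eigenvalues i ≤ (Uᵀ * B * U) i i := by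
    have h := (hAB.conjTranspose_mul_mul_same U).diag_nonneg (i := i)
    rw [conjTranspose_eq_transpose_of_trivial, Matrix.mul_sub, Matrix.sub_mul, hdiagA,
      Matrix.sub_apply, diagonal_apply_eq] at h
    linarith
  have hB' : (Uᵀ * B * U).PosSemidef := by
    simpa [conjTranspose_eq_transpose_of_trivial] using hB.conjTranspose_mul_mul_same U
  calc (A ^ m).trace = ∑ i, hA.1.eigenvalues i ^ m := by
        rw [hpow m, trace_mul_comm, ← Matrix.mul_assoc, hU', Matrix.one_mul, trace_diagonal]
    _ ≤ ∑ i, ((Uᵀ * B * U) ^ m) i i := sum_le_sum fun i _ =>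
        (pow_le_pow_left₀ (hA.eigenvalues_nonneg i) (hle i) m).trans
          (hB'.diag_pow_le_pow_diag m i)
    _ = (B ^ m).trace := by
        rw [← trace_conj (B ^ m), ← conj_pow]
        rfl

end Spectral

section Stochastic

variable {n : ℕ} {S T : Matrix (Fin n) (Fin n) ℝ}

theorem Matrix.dotProduct_mulVec_eq_sum (S : Matrix (Fin n) (Fin n) ℝ) (x : Fin n → ℝ) :
    x ⬝ᵥ (S *ᵥ x) = ∑ i, ∑ j, S i j * (x i * x j) := by
  simp only [dotProduct, mulVec, mul_sum]
  exact sum_congr rfl fun i _ => sum_congr rfl fun j _ => by ring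

/-- A symmetric row-stochastic matrix with diagonal at least `1/2` is positive semidefinite. -/
theorem RowStochastic.posSemidef (hS : RowStochastic S) (hsymm : S.IsSymm)
    (hdiag : ∀ i, (1 : ℝ) / 2 ≤ S i i) : S.PosSemidef := by
  refine .of_dotProduct_mulVec_nonneg (by simpa [IsHermitian] using hsymm.eq) fun x => ?_
  rw [star_trivial, dotProduct_mulVec_eq_sum]
  have hrow : ∑ i, ∑ j, S i j * x i ^ 2 = ∑ i, x i ^ 2 := by
    simp only [← sum_mul, hS.2, one_mul]
  have hcol : ∑ i, ∑ j, S i j * x j ^ 2 = ∑ i, x i ^ 2 := by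
    rw [sum_comm, ← hrow]
    exact sum_congr rfl fun i _ => sum_congr rfl fun j _ => by rw [hsymm.apply i j]
  have hexpand : ∑ i, ∑ j, S i j * (x i + x j) ^ 2 =
      ∑ i, ∑ j, S i j * x i ^ 2 + 2 * ∑ i, ∑ j, S i j * (x i * x j) +
        ∑ i, ∑ j, S i j * x j ^ 2 := by
    simp only [mul_sum, ← sum_add_distrib]
    exact sum_congr rfl fun i _ => sum_congr rfl fun j _ => by ring
  have hlower : ∑ i, 2 * x i ^ 2 ≤ ∑ i, ∑ j, S i j * (x i + x j) ^ 2 := by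
    refine sum_le_sum fun i _ => ?_
    calc 2 * x i ^ 2 ≤ S i i * (x i + x i) ^ 2 := by nlinarith [hdiag i, sq_nonneg (x i)]
      _ ≤ _ := single_le_sum (f := fun j => S i j * (x i + x j) ^ 2)
          (fun j _ => mul_nonneg (hS.1 i j) (sq_nonneg _)) (mem_univ i)
  rw [← mul_sum] at hlower
  linarith

/-- A symmetric matrix with zero row sums and nonpositive off-diagonal entries is
positive semidefinite. -/
theorem Matrix.IsSymm.posSemidef_of_sum_eq_zero (hsymm : S.IsSymm)
    (hrow : ∀ i, ∑ j, S i j = 0) (hoff : ∀ i j, i ≠ j → S i j ≤ 0) : S.PosSemidef := by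
  refine .of_dotProduct_mulVec_nonneg (by simpa [IsHermitian] using hsymm.eq) fun x => ?_
  rw [star_trivial, dotProduct_mulVec_eq_sum]
  have hrow' : ∑ i, ∑ j, S i j * x i ^ 2 = 0 := by
    simp only [← sum_mul, hrow, zero_mul, sum_const_zero]
  have hcol : ∑ i, ∑ j, S i j * x j ^ 2 = 0 := by
    rw [sum_comm, ← hrow']
    exact sum_congr rfl fun i _ => sum_congr rfl fun j _ => by rw [hsymm.apply i j]
  have hexpand : ∑ i, ∑ j, S i j * (x i - x j) ^ 2 =
      ∑ i, ∑ j, S i j * x i ^ 2 - 2 * ∑ i, ∑ j, S i j * (x i * x j) +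
        ∑ i, ∑ j, S i j * x j ^ 2 := by
    simp only [mul_sum, ← sum_add_distrib, ← sum_sub_distrib]
    exact sum_congr rfl fun i _ => sum_congr rfl fun j _ => by ring
  have hupper : ∑ i, ∑ j, S i j * (x i - x j) ^ 2 ≤ 0 := by
    refine sum_nonpos fun i _ => sum_nonpos fun j _ => ?_
    rcases eq_or_ne i j with rfl | hij
    · simp
    · exact mul_nonpos_of_nonpos_of_nonneg (hoff i j hij) (sq_nonneg _)
  linarith

theorem RowStochastic.mul (hS : RowStochastic S) (hT : RowStochastic T) :
    RowStochastic (S * T) := by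
  refine ⟨fun i j => ?_, fun i => ?_⟩
  · rw [mul_apply]
    exact sum_nonneg fun k _ => mul_nonneg (hS.1 i k) (hT.1 k j)
  simp only [mul_apply]
  rw [sum_comm]
  simp only [← mul_sum, hT.2, mul_one, hS.2]

theorem RowStochastic.pow (hS : RowStochastic S) (t : ℕ) : RowStochastic (S ^ t) := by
  induction t with
  | zero => exact ⟨fun i j => by rw [pow_zero, one_apply]; split_ifs <;> norm_num,
      fun i => by simp [one_apply]⟩
  | succ t ih => exact pow_succ S t ▸ ih.mul hS

/-- The total squared distance of the rows of `S ^ t` from uniform, as a trace. -/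
theorem RowStochastic.sum_sq_sub_eq_trace (hn : 0 < n) (hS : RowStochastic S)
    (hsymm : S.IsSymm) (t : ℕ) :
    ∑ i, ∑ j, ((S ^ t) i j - 1 / (n : ℝ)) ^ 2 = (S ^ (2 * t)).trace - 1 := by
  have hn' : (n : ℝ) ≠ 0 := by positivity
  have htrace : (S ^ (2 * t)).trace = ∑ i, ∑ j, (S ^ t) i j ^ 2 := by
    rw [two_mul, pow_add]
    simp only [trace, diag_apply, mul_apply]
    refine sum_congr rfl fun i _ => sum_congr rfl fun j _ => ?_
    rw [(hsymm.pow t).apply i j, sq]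
  have hexpand (i : Fin n) : ∑ j, ((S ^ t) i j - 1 / (n : ℝ)) ^ 2 =
      ∑ j, (S ^ t) i j ^ 2 - 1 / n := by
    calc ∑ j, ((S ^ t) i j - 1 / (n : ℝ)) ^ 2
        = ∑ j, (S ^ t) i j ^ 2 - 2 / n * ∑ j, (S ^ t) i j + ∑ _j : Fin n, (1 / (n : ℝ)) ^ 2 := by
          rw [mul_sum, ← sum_sub_distrib, ← sum_add_distrib]
          exact sum_congr rfl fun j _ => by ring
      _ = _ := by
          rw [(hS.pow t).2 i, sum_const, card_univ, Fintype.card_fin, nsmul_eq_mul]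
          field_simp
          ring
  simp only [hexpand, sum_sub_distrib, htrace, sum_const, card_univ, Fintype.card_fin,
    nsmul_eq_mul]
  field_simp

/-- Irreducibility and a positive diagonal give a power with all entries positive. -/
theorem MatIrreducible.exists_pow_pos (hirr : MatIrreducible S) (hS : RowStochastic S)
    (hdiag : ∀ i, 0 < S i i) : ∃ K : ℕ, 0 < K ∧ ∀ i j, 0 < (S ^ K) i j := by
  have mono {i j : Fin n} {k l : ℕ} (hkl : k ≤ l) (hk : 0 < (S ^ k) i j) : 0 < (S ^ l) i j := by
    induction l, hkl using Nat.le_induction with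
    | base => exact hk
    | succ l _ ih =>
      rw [pow_succ, mul_apply]
      exact (mul_pos ih (hdiag j)).trans_le <|
        single_le_sum (f := fun a => (S ^ l) i a * S a j)
          (fun a _ => mul_nonneg ((hS.pow l).1 i a) (hS.1 a j)) (mem_univ j)
  choose k _ hk using hirr
  refine ⟨∑ i, ∑ j, k i j + 1, Nat.succ_pos _, fun i j => mono ?_ (hk i j)⟩
  calc k i j ≤ ∑ j, k i j := single_le_sum (fun _ _ => Nat.zero_le _) (mem_univ j)
    _ ≤ ∑ i, ∑ j, k i j :=
      single_le_sum (f := fun i => ∑ j, k i j) (fun _ _ => Nat.zero_le _) (mem_univ i)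
    _ ≤ _ := Nat.le_succ _

/-- Powers of a symmetric row-stochastic matrix with positive entries converge to the uniform
matrix. -/
theorem RowStochastic.tendsto_pow_apply (hn : 0 < n) (hS : RowStochastic S) (hsymm : S.IsSymm)
    (hpos : ∀ i j, 0 < S i j) (i j : Fin n) :
    Tendsto (fun m => (S ^ m) i j) atTop (𝓝 (1 / (n : ℝ))) := by
  have hn' : (0 : ℝ) < n := by exact_mod_cast hn
  have : Nonempty (Fin n) := ⟨i⟩
  obtain ⟨p, hp⟩ := Finite.exists_min (fun p : Fin n × Fin n => S p.1 p.2)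
  obtain ⟨δ, hδ, hle⟩ : ∃ δ : ℝ, 0 < δ ∧ ∀ a b, δ ≤ S a b :=
    ⟨S p.1 p.2, hpos _ _, fun a b => hp (a, b)⟩
  have hr : 0 ≤ 1 - n * δ := by
    have h : ∑ _b : Fin n, δ ≤ ∑ b, S i b := sum_le_sum fun b _ => hle i b
    rw [hS.2 i, sum_const, card_univ, Fintype.card_fin, nsmul_eq_mul] at h
    linarith
  have hcolsum (b : Fin n) : ∑ a, S a b = 1 := by
    rw [← hS.2 b]
    exact sum_congr rfl fun a _ => hsymm.apply b a
  -- `S ^ m` exceeds the multiple `(1 - (1 - nδ) ^ m) / n` of the all-ones matrix entrywise.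
  have lower (m : ℕ) : ∀ a b, (1 - (1 - n * δ) ^ m) / n ≤ (S ^ m) a b := by
    induction m with
    | zero => intro a b; simpa using (hS.pow 0).1 a b
    | succ m ih =>
      intro a b
      have hsplit : (S ^ (m + 1)) a b =
          ∑ c, ((S ^ m) a c - (1 - (1 - n * δ) ^ m) / n) * (S c b - δ) +
            δ * ∑ c, (S ^ m) a c + (1 - (1 - n * δ) ^ m) / n * ∑ c, S c b
            - ∑ _c : Fin n, (1 - (1 - n * δ) ^ m) / n * δ := by
        rw [pow_succ, mul_apply, mul_sum, mul_sum, ← sum_add_distrib, ← sum_add_distrib,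
          ← sum_sub_distrib]
        exact sum_congr rfl fun c _ => by ring
      have hnonneg : 0 ≤ ∑ c, ((S ^ m) a c - (1 - (1 - n * δ) ^ m) / n) * (S c b - δ) :=
        sum_nonneg fun c _ => mul_nonneg (sub_nonneg.2 (ih a c)) (sub_nonneg.2 (hle c b))
      rw [hsplit, (hS.pow m).2 a, hcolsum b, sum_const, card_univ, Fintype.card_fin,
        nsmul_eq_mul]
      have harith : (1 - (1 - n * δ) ^ (m + 1)) / n = δ * 1 + (1 - (1 - n * δ) ^ m) / n * 1
          - n * ((1 - (1 - n * δ) ^ m) / n * δ) := by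
        field_simp
        ring
      linarith
  have upper (m : ℕ) : (S ^ m) i j ≤ 1 - (n - 1) * ((1 - (1 - n * δ) ^ m) / n) := by
    have h := sum_le_sum fun b (_ : b ∈ univ.erase j) => lower m i b
    rw [sum_const, card_erase_of_mem (mem_univ j), card_univ, Fintype.card_fin, nsmul_eq_mul,
      Nat.cast_sub hn, Nat.cast_one] at h
    have hsum := add_sum_erase univ (fun b => (S ^ m) i b) (mem_univ j)
    rw [(hS.pow m).2 i] at hsum
    linarith
  have hgeom : Tendsto (fun m : ℕ => (1 - (1 - n * δ) ^ m) / n) atTop (𝓝 (1 / (n : ℝ))) := by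
    have h := (tendsto_pow_atTop_nhds_zero_of_lt_one hr
      (by nlinarith : 1 - n * δ < 1)).const_sub 1 |>.div_const (n : ℝ)
    simpa using h
  refine tendsto_of_tendsto_of_tendsto_of_le_of_le hgeom ?_ (fun m => lower m i j) upper
  have h := (hgeom.const_mul ((n : ℝ) - 1)).const_sub 1
  have hlim : 1 - ((n : ℝ) - 1) * (1 / n) = 1 / n := by
    field_simp
    ring
  rwa [hlim] at h

/-- The convergence time of an irreducible symmetric row-stochastic matrix with positive diagonal
is attained. -/
theorem RowStochastic.convSet_nonempty (hn : 0 < n) (hS : RowStochastic S) (hsymm : S.IsSymm)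
    (hirr : MatIrreducible S) (hdiag : ∀ i, 0 < S i i) {ε : ℝ} (hε : 0 < ε) :
    (convSet S ε).Nonempty := by
  obtain ⟨K, hK, hpos⟩ := hirr.exists_pow_pos hS hdiag
  have hlim : Tendsto (fun m : ℕ => (1 / (n : ℝ)) *
      ∑ i, ∑ j, (((S ^ K) ^ m) i j - 1 / (n : ℝ)) ^ 2) atTop (𝓝 0) := by
    have h := (tendsto_finsetSum univ fun i (_ : i ∈ univ) =>
      tendsto_finsetSum univ fun j (_ : j ∈ univ) =>
        (((hS.pow K).tendsto_pow_apply hn (hsymm.pow K) hpos i j).sub_const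
          (1 / (n : ℝ))).pow 2).const_mul (1 / (n : ℝ))
    simpa using h
  obtain ⟨m, hm, hm1⟩ := ((hlim.eventually_lt_const hε).and (eventually_ge_atTop 1)).exists
  exact ⟨K * m, Nat.mul_pos hK hm1, by simpa only [pow_mul] using hm⟩

end Stochastic

/-- Main speed-of-learning theorem: moving weight from off-diagonal entries to the
diagonal of a symmetric row-stochastic matrix with enough self-weight (confirmation
bias) weakly increases `trace (S^(2t))` for every `t ≥ 1`, and consequently weakly
increases the average convergence time, both minima being attained. -/
theorem confirmation_bias_slows_learning {n : ℕ} (hn : 0 < n)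
    (T Tstar : Matrix (Fin n) (Fin n) ℝ)
    (hTsymm : T.IsSymm) (hTstarsymm : Tstar.IsSymm)
    (hT : RowStochastic T) (hTstar : RowStochastic Tstar)
    (hdiag : ∀ i, (1 : ℝ) / 2 ≤ T i i)
    (hoff : ∀ i j, i ≠ j → Tstar i j ≤ T i j)
    (hrows : ∀ i, ∑ j, Tstar i j = ∑ j, T i j)
    (hirr : MatIrreducible T) (hirrstar : MatIrreducible Tstar) :
    (∀ t : ℕ, 1 ≤ t → (T ^ (2 * t)).trace ≤ (Tstar ^ (2 * t)).trace) ∧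
    ∀ ε : ℝ, 0 < ε →
      (convSet T ε).Nonempty ∧ (convSet Tstar ε).Nonempty ∧
      convTime T ε ≤ convTime Tstar ε := by
  have hdiagstar (i : Fin n) : T i i ≤ Tstar i i := by
    have h := sum_le_sum fun j (hj : j ∈ univ.erase i) => hoff i j (ne_of_mem_erase hj).symm
    have h1 := add_sum_erase univ (fun j => T i j) (mem_univ i)
    have h2 := add_sum_erase univ (fun j => Tstar i j) (mem_univ i)
    linarith [hrows i]
  have hdiff : (Tstar - T).PosSemidef :=
    (hTstarsymm.sub hTsymm).posSemidef_of_sum_eq_zero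
      (fun i => by simp [sum_sub_distrib, hrows i])
      fun i j hij => sub_nonpos.2 (hoff i j hij)
  have htrace (t : ℕ) : (T ^ (2 * t)).trace ≤ (Tstar ^ (2 * t)).trace :=
    (hT.posSemidef hTsymm hdiag).trace_pow_le_trace_pow hdiff (2 * t)
  refine ⟨fun t _ => htrace t, fun ε hε => ?_⟩
  have hpos (i : Fin n) : 0 < T i i := by linarith [hdiag i]
  have hne := hTstar.convSet_nonempty hn hTstarsymm hirrstar
    (fun i => (hpos i).trans_le (hdiagstar i)) hε
  refine ⟨hT.convSet_nonempty hn hTsymm hirr hpos hε, hne, Nat.sInf_le ?_⟩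
  obtain ⟨ht, hlt⟩ := Nat.sInf_mem hne
  refine ⟨ht, lt_of_le_of_lt ?_ hlt⟩
  rw [hT.sum_sq_sub_eq_trace hn hTsymm, hTstar.sum_sq_sub_eq_trace hn hTstarsymm]
  exact mul_le_mul_of_nonneg_left (sub_le_sub_right (htrace _) 1) (by positivity)
end

section
/- Fix an index i. Let T and T* be n×n irreducible row-stochastic matrices with (unique) stationary distributions π and π* respectively (πᵀT = πᵀ, π*ᵀT* = π*ᵀ, entries positive, summing to 1). Suppose T*_{kj} = T_{kj} for all k ≠ i and all j (only row i differs), T*_{ij} ≤ T_{ij} for all j ≠ i, and T*_{ii} > T_{ii}. Then π*_i > π_i: agent i's influence strictly increases. -/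
open Matrix

/-- Multiplying a row vector by a row-stochastic matrix preserves its total mass. -/
lemma RowStochastic.sum_vecMul {n : ℕ} {T : Matrix (Fin n) (Fin n) ℝ} (hT : RowStochastic T)
    (y : Fin n → ℝ) : ∑ j, (y ᵥ* T) j = ∑ j, y j := by
  simp only [vecMul, dotProduct]
  rw [Finset.sum_comm]
  simp [← Finset.mul_sum, hT.2]

/-- A subinvariant row vector of a row-stochastic matrix is invariant. -/
lemma RowStochastic.vecMul_eq_of_le {n : ℕ} {T : Matrix (Fin n) (Fin n) ℝ}
    (hT : RowStochastic T) {y : Fin n → ℝ} (hy : ∀ j, y j ≤ (y ᵥ* T) j) : y ᵥ* T = y := by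
  have h := (Finset.sum_eq_sum_iff_of_le fun j _ => hy j).1 (hT.sum_vecMul y).symm
  exact funext fun j => (h j (Finset.mem_univ j)).symm

lemma RowStochastic.pow_nonneg {n : ℕ} {T : Matrix (Fin n) (Fin n) ℝ} (hT : RowStochastic T)
    (k : ℕ) (a b : Fin n) : 0 ≤ (T ^ k) a b := by
  induction k generalizing b with
  | zero => rw [pow_zero, one_apply]; split_ifs <;> norm_num
  | succ k ih =>
    rw [pow_succ, mul_apply]
    exact Finset.sum_nonneg fun c _ => mul_nonneg (ih c) (hT.1 c b)

/-- A nonnegative subinvariant row vector of an irreducible row-stochastic matrix vanishes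
as soon as one of its entries does. -/
lemma RowStochastic.eq_zero_of_le_vecMul {n : ℕ} {T : Matrix (Fin n) (Fin n) ℝ}
    (hT : RowStochastic T) (hirr : MatIrreducible T) {y : Fin n → ℝ} (hy0 : ∀ j, 0 ≤ y j)
    (hy : ∀ j, y j ≤ (y ᵥ* T) j) {i : Fin n} (hi : y i = 0) (j : Fin n) : y j = 0 := by
  have hinv : ∀ k : ℕ, y ᵥ* T ^ k = y := by
    intro k
    induction k with
    | zero => simp
    | succ k ih => rw [pow_succ, ← vecMul_vecMul, ih, hT.vecMul_eq_of_le hy]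
  obtain ⟨k, -, hk⟩ := hirr j i
  have hsum : ∑ l, y l * (T ^ k) l i = 0 := by
    simpa [vecMul, dotProduct, hi] using congrFun (hinv k) i
  have hterm := (Finset.sum_eq_zero_iff_of_nonneg
    fun l _ => mul_nonneg (hy0 l) (hT.pow_nonneg k l i)).1 hsum j (Finset.mem_univ j)
  exact (mul_eq_zero.1 hterm).resolve_right (ne_of_gt hk)

/-- Changing only row `i` of a matrix changes the product with a row vector by a multiple of
the change in row `i`. -/
lemma vecMul_apply_of_rows_eq {n : ℕ} {T S : Matrix (Fin n) (Fin n) ℝ} {i : Fin n}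
    (hrows : ∀ k, k ≠ i → ∀ j, S k j = T k j) (q : Fin n → ℝ) (j : Fin n) :
    (q ᵥ* S) j = (q ᵥ* T) j + q i * (S i j - T i j) := by
  rw [← sub_eq_iff_eq_add']
  simp only [vecMul, dotProduct]
  rw [← Finset.sum_sub_distrib, Finset.sum_eq_single i]
  · ring
  · intro k _ hk
    rw [hrows k hk j, sub_self]
  · simp

/-- If exactly one agent `i` cuts links — only row `i` differs between `T` and `T*`,
with the weights on others weakly decreasing and the self-weight strictly increasing —
then agent `i`'s influence (stationary weight) strictly increases. -/
theorem influence_strictly_increases_of_single_agent_cut {n : ℕ}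
    (T Tstar : Matrix (Fin n) (Fin n) ℝ) (i : Fin n)
    (p pstar : Fin n → ℝ)
    (hT : RowStochastic T) (hTstar : RowStochastic Tstar)
    (hirr : MatIrreducible T) (hirrstar : MatIrreducible Tstar)
    (hp : Matrix.vecMul p T = p) (hppos : ∀ j, 0 < p j) (hpsum : ∑ j, p j = 1)
    (hpstar : Matrix.vecMul pstar Tstar = pstar) (hpstarpos : ∀ j, 0 < pstar j)
    (hpstarsum : ∑ j, pstar j = 1)
    (hrows : ∀ k, k ≠ i → ∀ j, Tstar k j = T k j)
    (hoff : ∀ j, j ≠ i → Tstar i j ≤ T i j)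
    (hdiag : T i i < Tstar i i) :
    p i < pstar i := by
  set c := pstar i / p i with hc
  set x : Fin n → ℝ := pstar - c • p with hx
  have hxi : x i = 0 := by simp [hx, hc, (hppos i).ne']
  have hxT : ∀ j, (x ᵥ* T) j = x j - pstar i * (Tstar i j - T i j) := by
    intro j
    have h := vecMul_apply_of_rows_eq hrows pstar j
    rw [hpstar] at h
    simp only [hx, sub_vecMul, smul_vecMul, hp, Pi.sub_apply]
    linarith
  have hxle : ∀ j, x j ≤ 0 := by
    intro j
    have hmono : ∀ l, (x ᵥ* T) l ≤ ((fun k => max (x k) 0) ᵥ* T) l := by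
      intro l
      simp only [vecMul, dotProduct]
      exact Finset.sum_le_sum fun k _ => mul_le_mul_of_nonneg_right (le_max_left _ _) (hT.1 k l)
    have hnonneg : ∀ l, 0 ≤ ((fun k => max (x k) 0) ᵥ* T) l := by
      intro l
      simp only [vecMul, dotProduct]
      exact Finset.sum_nonneg fun k _ => mul_nonneg (le_max_right _ _) (hT.1 k l)
    refine max_eq_right_iff.1 <| hT.eq_zero_of_le_vecMul hirr (y := fun k => max (x k) 0)
      (fun _ => le_max_right _ _) (fun l => max_le ?_ (hnonneg l)) (i := i) (by simp [hxi]) j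
    rcases eq_or_ne l i with rfl | hl
    · exact hxi.trans_le (hnonneg l)
    · refine le_trans ?_ (hmono l)
      rw [hxT]
      nlinarith [hoff l hl, hpstarpos i]
  have hxlt : ∃ k, x k < 0 := by
    by_contra! h
    have hx0 : x = 0 := funext fun k => le_antisymm (hxle k) (h k)
    have hi := hxT i
    rw [hx0] at hi
    simp only [zero_vecMul, Pi.zero_apply] at hi
    nlinarith [mul_pos (hpstarpos i) (sub_pos.2 hdiag)]
  obtain ⟨k, hk⟩ := hxlt
  have hsum : ∑ j, x j < 0 :=
    Finset.sum_neg' (fun j _ => hxle j) ⟨k, Finset.mem_univ k, hk⟩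
  have hsum_eq : ∑ j, x j = 1 - c := by
    simp [hx, Finset.sum_sub_distrib, ← Finset.mul_sum, hpsum, hpstarsum]
  exact (one_lt_div (hppos i)).1 (by linarith)
end

section
/- Let T be an n×n row-stochastic matrix (n ≥ 2) with T_{jj} < 1 for every j, and let s ∈ ℝⁿ satisfy sᵀT = sᵀ (s is a left eigenvector for eigenvalue 1). Then for every index i: (1 − T_{ii} − Σ_{j≠i} T_{ji} T_{ij} (1 − T_{jj})^{-1}) · s_i = Σ_{j≠i} (1 − T_{jj})^{-1} T_{ji} · ( Σ_{k ∉ {i,j}} T_{kj} s_k ). -/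
/-- The stationary equation at `j`, with the diagonal term moved to the left. -/
lemma one_sub_diag_mul_of_vecMul_eq {ι R : Type*} [Fintype ι] [DecidableEq ι] [CommRing R]
    {T : Matrix ι ι R} {s : ι → R} (hs : Matrix.vecMul s T = s) (j : ι) :
    (1 - T j j) * s j = ∑ k ∈ Finset.univ.filter (fun k => k ≠ j), T k j * s k := by
  have hj : ∑ k, T k j * s k = s j := by
    simpa [Matrix.vecMul, dotProduct, mul_comm] using congrFun hs j
  rw [Finset.filter_ne', sub_mul, one_mul, sub_eq_iff_eq_add,
    Finset.sum_erase_add _ _ (Finset.mem_univ j), hj]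

/-- The stationary equation at `j`, with the contribution of a second index `i` isolated. -/
lemma one_sub_diag_mul_eq_add_of_vecMul_eq {ι R : Type*} [Fintype ι] [DecidableEq ι]
    [CommRing R] {T : Matrix ι ι R} {s : ι → R} (hs : Matrix.vecMul s T = s) {i j : ι}
    (hij : j ≠ i) :
    (1 - T j j) * s j =
      T i j * s i + ∑ k ∈ Finset.univ.filter (fun k => k ≠ i ∧ k ≠ j), T k j * s k := by
  have hset : Finset.univ.filter (fun k => k ≠ i ∧ k ≠ j) =
      (Finset.univ.filter (fun k => k ≠ j)).erase i := by
    ext k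
    simp
  rw [one_sub_diag_mul_of_vecMul_eq hs, hset, Finset.add_sum_erase _ (fun k => T k j * s k)]
  simpa using hij.symm

/-- The two-step substitution identity for a left eigenvector of a row-stochastic
matrix: for every `i`,
`(1 - T i i - ∑_{j≠i} T j i * T i j * (1 - T j j)⁻¹) * s i
  = ∑_{j≠i} (1 - T j j)⁻¹ * T j i * (∑_{k∉{i,j}} T k j * s k)`. -/
theorem two_step_stationary_identity {n : ℕ} (hn : 2 ≤ n)
    (T : Matrix (Fin n) (Fin n) ℝ)
    (hnonneg : ∀ i j, 0 ≤ T i j)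
    (hrow : ∀ i, ∑ j, T i j = 1)
    (hdiag : ∀ j, T j j < 1)
    (s : Fin n → ℝ)
    (hs : Matrix.vecMul s T = s) :
    ∀ i : Fin n,
      (1 - T i i - ∑ j ∈ Finset.univ.filter (fun j => j ≠ i),
          T j i * T i j * (1 - T j j)⁻¹) * s i
        = ∑ j ∈ Finset.univ.filter (fun j => j ≠ i),
            (1 - T j j)⁻¹ * T j i *
              (∑ k ∈ Finset.univ.filter (fun k => k ≠ i ∧ k ≠ j), T k j * s k) := by
  intro i
  rw [sub_mul, one_sub_diag_mul_of_vecMul_eq hs i, Finset.sum_mul, ← Finset.sum_sub_distrib]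
  refine Finset.sum_congr rfl fun j hj => ?_
  have hji : j ≠ i := (Finset.mem_filter.mp hj).2
  have hne : 1 - T j j ≠ 0 := (sub_pos.mpr (hdiag j)).ne'
  rw [← sub_eq_of_eq_add' (one_sub_diag_mul_eq_add_of_vecMul_eq hs hji)]
  field_simp
end

section
/- Let T be an n×n row-stochastic matrix and fix an index i, and assume T_{jj} < 1 for every j ≠ i. Then Σ_{j≠i} T_{ji} T_{ij} (1 − T_{jj})^{-1} ≤ 1 − T_{ii}. Moreover, if there exists some j ≠ i with T_{ij} > 0 and T_{ji} = 0, the inequality is strict: 1 − T_{ii} − Σ_{j≠i} T_{ji} T_{ij} (1 − T_{jj})^{-1} > 0. -/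
/-- An off-diagonal entry of a row-stochastic matrix is at most one minus the diagonal entry
of its row. -/
lemma offDiag_le_one_sub_diag {ι : Type*} [Fintype ι] {T : Matrix ι ι ℝ}
    (hnonneg : ∀ i j, 0 ≤ T i j) (hrow : ∀ i, ∑ j, T i j = 1) {i j : ι} (hji : j ≠ i) :
    T j i ≤ 1 - T j j := by
  classical
  have h : ∑ k ∈ {j, i}, T j k ≤ ∑ k, T j k :=
    Finset.sum_le_sum_of_subset_of_nonneg (Finset.subset_univ _) fun k _ _ => hnonneg j k
  rw [Finset.sum_pair hji, hrow] at h
  linarith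

/-- For a row-stochastic matrix `T` with `T j j < 1` for all `j ≠ i`:
`∑_{j≠i} T j i * T i j * (1 - T j j)⁻¹ ≤ 1 - T i i`, with strict inequality
(i.e. `1 - T i i - ∑_{j≠i} T j i * T i j * (1 - T j j)⁻¹ > 0`) whenever there is
some `j ≠ i` with `T i j > 0` and `T j i = 0`. -/
theorem influencer_coefficient_positive {n : ℕ}
    (T : Matrix (Fin n) (Fin n) ℝ) (i : Fin n)
    (hnonneg : ∀ i j, 0 ≤ T i j)
    (hrow : ∀ i, ∑ j, T i j = 1)
    (hdiag : ∀ j, j ≠ i → T j j < 1) :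
    (∑ j ∈ Finset.univ.filter (fun j => j ≠ i), T j i * T i j * (1 - T j j)⁻¹
        ≤ 1 - T i i) ∧
    ((∃ j, j ≠ i ∧ 0 < T i j ∧ T j i = 0) →
      0 < 1 - T i i
          - ∑ j ∈ Finset.univ.filter (fun j => j ≠ i), T j i * T i j * (1 - T j j)⁻¹) := by
  have hsum : ∑ j ∈ Finset.univ.filter (fun j => j ≠ i), T i j = 1 - T i i := by
    rw [Finset.filter_ne', ← hrow i, ← Finset.add_sum_erase _ _ (Finset.mem_univ i)]
    ring
  have hterm : ∀ j ∈ Finset.univ.filter (fun j => j ≠ i),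
      T j i * T i j * (1 - T j j)⁻¹ ≤ T i j := by
    intro j hj
    have hji : j ≠ i := (Finset.mem_filter.mp hj).2
    rw [← div_eq_mul_inv, div_le_iff₀ (sub_pos.mpr (hdiag j hji)), mul_comm]
    exact mul_le_mul_of_nonneg_left (offDiag_le_one_sub_diag hnonneg hrow hji) (hnonneg i j)
  rw [← hsum]
  refine ⟨Finset.sum_le_sum hterm, ?_⟩
  rintro ⟨j, hji, hpos, hzero⟩
  refine sub_pos.mpr (Finset.sum_lt_sum hterm ⟨j, by simp [hji], ?_⟩)
  simpa [hzero] using hpos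
end

section
/- Let T be an n×n row-stochastic matrix, x₀ ∈ ℝⁿ a vector of initial beliefs, and μ ∈ ℝ. Suppose the mean-field hypothesis holds: for every i and every k ∈ ℕ, Σ_{j≠i} T_{ij} (T_{jj})^k (x_{j,0} − μ) = 0. Define beliefs at time t by x_t = T^t x₀. Then for every agent i and every time t ∈ ℕ, x_{i,t} = (1 − (T_{ii})^t) μ + (T_{ii})^t x_{i,0}. -/
/-- Mean-field learning lemma: if for every agent `i` and every `k`,
`∑_{j≠i} T i j * (T j j)^k * (x₀ j - μ) = 0`, then under DeGroot learning
`x_t = T^t x₀` every agent's belief at time `t` is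
`x_{i,t} = (1 - (T i i)^t) μ + (T i i)^t x_{i,0}`. -/
theorem mean_field_learning {n : ℕ}
    (T : Matrix (Fin n) (Fin n) ℝ)
    (hnonneg : ∀ i j, 0 ≤ T i j)
    (hrow : ∀ i, ∑ j, T i j = 1)
    (x₀ : Fin n → ℝ) (μ : ℝ)
    (hmf : ∀ i : Fin n, ∀ k : ℕ,
      ∑ j ∈ Finset.univ.filter (fun j => j ≠ i), T i j * (T j j) ^ k * (x₀ j - μ) = 0) :
    ∀ (i : Fin n) (t : ℕ),
      ((T ^ t).mulVec x₀) i = (1 - (T i i) ^ t) * μ + (T i i) ^ t * x₀ i := by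
  intro i t
  induction t generalizing i with
  | zero => simp
  | succ t ih =>
    have hsplit : ∑ j, T i j * (T j j) ^ t * (x₀ j - μ) =
        T i i * (T i i) ^ t * (x₀ i - μ) := by
      have h := hmf i t
      rw [Finset.filter_ne'] at h
      rw [← Finset.add_sum_erase _ _ (Finset.mem_univ i), h, add_zero]
    calc ((T ^ (t + 1)).mulVec x₀) i
        = ∑ j, T i j * ((T ^ t).mulVec x₀) j := by
          rw [pow_succ', ← Matrix.mulVec_mulVec]
          rfl
      _ = ∑ j, (T i j * μ + T i j * (T j j) ^ t * (x₀ j - μ)) := by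
          refine Finset.sum_congr rfl fun j _ => ?_
          rw [ih j]
          ring
      _ = μ + T i i * (T i i) ^ t * (x₀ i - μ) := by
          rw [Finset.sum_add_distrib, ← Finset.sum_mul, hrow, hsplit, one_mul]
      _ = (1 - (T i i) ^ (t + 1)) * μ + (T i i) ^ (t + 1) * x₀ i := by ring
end

section
/- Let T and T* be n×n row-stochastic matrices with nonnegative diagonal entries, let x₀ ∈ ℝⁿ and let μ = (1/n) Σ_{i} x_{i,0}. Suppose the mean-field hypothesis holds for both (T, x₀, μ) and (T*, x₀, μ): for every i and every k ∈ ℕ, Σ_{j≠i} T_{ij} (T_{jj})^k (x_{j,0} − μ) = 0 and Σ_{j≠i} T*_{ij} (T*_{jj})^k (x_{j,0} − μ) = 0. Define x_t = T^t x₀, x*_t = (T*)^t x₀ and the polarization var(y) = (1/n) Σ_i (y_i − μ)². Then for every t ∈ ℕ, var(x_t) = (1/n) Σ_i (T_{ii})^{2t} (x_{i,0} − μ)² and var(x*_t) = (1/n) Σ_i (T*_{ii})^{2t} (x_{i,0} − μ)²; and if in addition T*_{ii} ≥ T_{ii} for every i, then var(x*_t) ≥ var(x_t) for every t. That is, polarization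 at each point in time is weakly increasing in the weights agents place on themselves. -/
/-- Under the mean-field hypothesis, the deviation of each agent from `μ` decays geometrically at
the rate given by the self-weight of that agent. -/
theorem pow_mulVec_sub_eq_of_meanField {ι R : Type*} [Fintype ι] [DecidableEq ι] [CommRing R]
    {T : Matrix ι ι R} (hrow : ∀ i, ∑ j, T i j = 1) {x₀ : ι → R} {μ : R}
    (hmf : ∀ i : ι, ∀ k : ℕ,
      ∑ j ∈ Finset.univ.filter (fun j => j ≠ i), T i j * (T j j) ^ k * (x₀ j - μ) = 0)
    (t : ℕ) (i : ι) :
    ((T ^ t).mulVec x₀) i - μ = (T i i) ^ t * (x₀ i - μ) := by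
  induction t generalizing i with
  | zero => simp
  | succ t ih =>
    calc ((T ^ (t + 1)).mulVec x₀) i - μ
        = ∑ j, T i j * ((T ^ t).mulVec x₀) j - (∑ j, T i j) * μ := by
          rw [pow_succ', ← Matrix.mulVec_mulVec, hrow, one_mul]
          rfl
      _ = ∑ j, T i j * (T j j) ^ t * (x₀ j - μ) := by
          rw [Finset.sum_mul, ← Finset.sum_sub_distrib]
          refine Finset.sum_congr rfl fun j _ => ?_
          rw [← mul_sub, ih, mul_assoc]
      _ = (T i i) ^ (t + 1) * (x₀ i - μ) := by
          rw [← Finset.add_sum_erase _ _ (Finset.mem_univ i), ← Finset.filter_ne', hmf,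
            add_zero, pow_succ']

/-- Under the mean-field hypothesis, the sum of squared deviations from `μ` at time `t` is
determined by the self-weights and the initial deviations. -/
theorem sum_sq_pow_mulVec_sub_eq_of_meanField {ι R : Type*} [Fintype ι] [DecidableEq ι]
    [CommRing R] {T : Matrix ι ι R} (hrow : ∀ i, ∑ j, T i j = 1) {x₀ : ι → R} {μ : R}
    (hmf : ∀ i : ι, ∀ k : ℕ,
      ∑ j ∈ Finset.univ.filter (fun j => j ≠ i), T i j * (T j j) ^ k * (x₀ j - μ) = 0)
    (t : ℕ) :
    ∑ i, (((T ^ t).mulVec x₀) i - μ) ^ 2 = ∑ i, (T i i) ^ (2 * t) * (x₀ i - μ) ^ 2 := by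
  refine Finset.sum_congr rfl fun i _ => ?_
  rw [pow_mulVec_sub_eq_of_meanField hrow hmf, mul_pow, ← pow_mul, mul_comm t]

/-- Under the mean-field hypothesis, polarization at time `t` equals
`(1/n) ∑ i (T i i)^(2t) (x₀ i - μ)²`, and hence polarization at each point in time
is weakly increasing in the weights agents place on themselves (confirmation bias). -/
theorem polarization_increasing_in_self_weight {n : ℕ} (hn : 0 < n)
    (T Tstar : Matrix (Fin n) (Fin n) ℝ)
    (hTnonneg : ∀ i j, 0 ≤ T i j) (hTrow : ∀ i, ∑ j, T i j = 1)
    (hTstarnonneg : ∀ i j, 0 ≤ Tstar i j) (hTstarrow : ∀ i, ∑ j, Tstar i j = 1)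
    (hTdiag : ∀ i, 0 ≤ T i i) (hTstardiag : ∀ i, 0 ≤ Tstar i i)
    (x₀ : Fin n → ℝ) (μ : ℝ) (hμ : μ = (1 / (n : ℝ)) * ∑ i, x₀ i)
    (hmf : ∀ i : Fin n, ∀ k : ℕ,
      ∑ j ∈ Finset.univ.filter (fun j => j ≠ i), T i j * (T j j) ^ k * (x₀ j - μ) = 0)
    (hmfstar : ∀ i : Fin n, ∀ k : ℕ,
      ∑ j ∈ Finset.univ.filter (fun j => j ≠ i),
        Tstar i j * (Tstar j j) ^ k * (x₀ j - μ) = 0) :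
    (∀ t : ℕ,
      (1 / (n : ℝ)) * ∑ i, (((T ^ t).mulVec x₀) i - μ) ^ 2
        = (1 / (n : ℝ)) * ∑ i, (T i i) ^ (2 * t) * (x₀ i - μ) ^ 2) ∧
    (∀ t : ℕ,
      (1 / (n : ℝ)) * ∑ i, (((Tstar ^ t).mulVec x₀) i - μ) ^ 2
        = (1 / (n : ℝ)) * ∑ i, (Tstar i i) ^ (2 * t) * (x₀ i - μ) ^ 2) ∧
    ((∀ i, T i i ≤ Tstar i i) →
      ∀ t : ℕ,
        (1 / (n : ℝ)) * ∑ i, (((T ^ t).mulVec x₀) i - μ) ^ 2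
          ≤ (1 / (n : ℝ)) * ∑ i, (((Tstar ^ t).mulVec x₀) i - μ) ^ 2) := by
  have hT := sum_sq_pow_mulVec_sub_eq_of_meanField hTrow hmf
  have hTstar := sum_sq_pow_mulVec_sub_eq_of_meanField hTstarrow hmfstar
  refine ⟨fun t => by rw [hT], fun t => by rw [hTstar], fun hle t => ?_⟩
  rw [hT, hTstar]
  gcongr with i
  · exact hTdiag i
  · exact hle i
end

section
/- Let T be an n×n row-stochastic matrix with T_{ii} ∈ [0,1] for every i, let x₀ ∈ ℝⁿ, and let μ ∈ ℝ. Suppose the mean-field hypothesis holds for (T, x₀, μ): for every i and every k ∈ ℕ, Σ_{j≠i} T_{ij} (T_{jj})^k (x_{j,0} − μ) = 0. Define x_t = T^t x₀. If μ < 1/2 and the number of agents with x_{i,0} < 1/2 is strictly greater than n/2, then for every time t ∈ ℕ the number of agents with x_{i,t} < 1/2 is strictly greater than n/2. In particular, the Left candidate (the one with ideology 0, supported by voters with belief below 1/2) wins the election at every time t: no shock election ever occurs. -/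
/-- Under the mean-field hypothesis, each agent's belief evolves in closed form, its deviation
from `μ` shrinking by the factor `T i i` at each step. -/
theorem mulVec_pow_eq_of_meanField {ι : Type*} [Fintype ι] [DecidableEq ι]
    (T : Matrix ι ι ℝ) (hrow : ∀ i, ∑ j, T i j = 1) (x₀ : ι → ℝ) (μ : ℝ)
    (hmf : ∀ i : ι, ∀ k : ℕ,
      ∑ j ∈ Finset.univ.filter (fun j => j ≠ i), T i j * (T j j) ^ k * (x₀ j - μ) = 0)
    (t : ℕ) (i : ι) :
    ((T ^ t).mulVec x₀) i = μ + (T i i) ^ t * (x₀ i - μ) := by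
  induction t generalizing i with
  | zero => simp
  | succ t ih =>
    rw [pow_succ', ← Matrix.mulVec_mulVec]
    have hsplit : ∑ j, T i j * (T j j) ^ t * (x₀ j - μ)
        = T i i * (T i i) ^ t * (x₀ i - μ) := by
      rw [← Finset.add_sum_erase _ _ (Finset.mem_univ i), ← Finset.filter_ne', hmf i t, add_zero]
    calc (T.mulVec ((T ^ t).mulVec x₀)) i
        = ∑ j, T i j * (μ + (T j j) ^ t * (x₀ j - μ)) :=
          Finset.sum_congr rfl fun j _ => by rw [ih j]
      _ = (∑ j, T i j) * μ + ∑ j, T i j * (T j j) ^ t * (x₀ j - μ) := by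
          rw [Finset.sum_mul, ← Finset.sum_add_distrib]
          exact Finset.sum_congr rfl fun j _ => by ring
      _ = μ + (T i i) ^ (t + 1) * (x₀ i - μ) := by
          rw [hrow i, hsplit]
          ring

/-- No shock elections without confirmation bias: under the mean-field hypothesis,
if the societal mean `μ` is below `1/2` and a strict majority of agents initially hold
beliefs below `1/2`, then at every time `t` a strict majority of agents hold beliefs
below `1/2`, so the Left candidate wins every election. -/
theorem no_shock_election_without_confirmation_bias {n : ℕ}
    (T : Matrix (Fin n) (Fin n) ℝ)
    (hnonneg : ∀ i j, 0 ≤ T i j)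
    (hrow : ∀ i, ∑ j, T i j = 1)
    (hdiag : ∀ i, T i i ∈ Set.Icc (0 : ℝ) 1)
    (x₀ : Fin n → ℝ) (μ : ℝ)
    (hmf : ∀ i : Fin n, ∀ k : ℕ,
      ∑ j ∈ Finset.univ.filter (fun j => j ≠ i), T i j * (T j j) ^ k * (x₀ j - μ) = 0)
    (hμ : μ < 1 / 2)
    (hmaj : n < 2 * (Finset.univ.filter (fun i => x₀ i < 1 / 2)).card) :
    ∀ t : ℕ,
      n < 2 * (Finset.univ.filter (fun i => ((T ^ t).mulVec x₀) i < 1 / 2)).card := by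
  intro t
  refine hmaj.trans_le (Nat.mul_le_mul_left 2 (Finset.card_le_card ?_))
  refine Finset.monotone_filter_right _ fun i _ hi => ?_
  rw [mulVec_pow_eq_of_meanField T hrow x₀ μ hmf t i]
  have h0 : 0 ≤ (T i i) ^ t := pow_nonneg (hdiag i).1 t
  have h1 : (T i i) ^ t ≤ 1 := pow_le_one₀ (hdiag i).1 (hdiag i).2
  rcases le_total (x₀ i) μ with h | h
  · nlinarith
  · nlinarith
end

section
/- There exist a 5×5 row-stochastic matrix S that is irreducible and aperiodic and a vector x₀ ∈ [0,1]⁵ such that: (i) the limit lim_{t→∞} S^t x₀ exists and is a constant vector whose common value is strictly less than 1/2 (society reaches a consensus favoring the Left candidate); (ii) at most 2 of the 5 entries of x₀ exceed 1/2 (the Right does not have a majority initially); but (iii) at least 3 of the 5 entries of S·x₀ exceed 1/2 (the Right wins a majority at time t = 1). In other words, a shock election can occur under DeGroot learning on a network altered by confirmation bias. -/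
/-- A nonnegative matrix is aperiodic (primitive, together with irreducibility) if some
power of it has all entries strictly positive. -/
def MatAperiodic {n : ℕ} (T : Matrix (Fin n) (Fin n) ℝ) : Prop :=
  ∃ k : ℕ, 0 < k ∧ ∀ i j, 0 < (T ^ k) i j

open Matrix in
/-- If `v` is an eigenvector of `S` with eigenvalue `r`, then it is an eigenvector of `S ^ t`
with eigenvalue `r ^ t`. -/
lemma pow_mulVec_of_mulVec_eq_smul {n : ℕ} {S : Matrix (Fin n) (Fin n) ℝ} {v : Fin n → ℝ} {r : ℝ}
    (h : S *ᵥ v = r • v) (t : ℕ) : (S ^ t) *ᵥ v = r ^ t • v := by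
  induction t with
  | zero => simp
  | succ t ih => rw [pow_succ, ← mulVec_mulVec, h, mulVec_smul, ih, smul_smul, pow_succ']

open Matrix in
/-- If the constant vectors are fixed by `S` and `v` is an eigenvector with eigenvalue of absolute
value less than one, then the beliefs started at `c + v` converge to the consensus `c`. -/
lemma tendsto_pow_mulVec_const_add {n : ℕ} {S : Matrix (Fin n) (Fin n) ℝ} {v : Fin n → ℝ}
    {r c : ℝ} (hc : S *ᵥ (fun _ => c) = fun _ => c) (hv : S *ᵥ v = r • v) (hr : |r| < 1) :
    Filter.Tendsto (fun t : ℕ => (S ^ t) *ᵥ ((fun _ => c) + v)) Filter.atTop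
      (nhds fun _ => c) := by
  have hc' : S *ᵥ (fun _ => c) = (1 : ℝ) • fun _ => c := by rw [hc, one_smul]
  simp only [mulVec_add, pow_mulVec_of_mulVec_eq_smul hc', pow_mulVec_of_mulVec_eq_smul hv,
    one_pow, one_smul]
  simpa using ((tendsto_pow_atTop_nhds_zero_of_abs_lt_one hr).smul_const v).const_add
    (fun _ : Fin n => c)

/-- A five-agent network with two groups, `{0, 1}` and `{2, 3, 4}`, in which every agent puts
weight `1/4` on their own group and `3/4` on the other one. -/
noncomputable def shockNetwork : Matrix (Fin 5) (Fin 5) ℝ :=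
  !![1/8, 1/8, 1/4, 1/4, 1/4;
     1/8, 1/8, 1/4, 1/4, 1/4;
     3/8, 3/8, 1/12, 1/12, 1/12;
     3/8, 3/8, 1/12, 1/12, 1/12;
     3/8, 3/8, 1/12, 1/12, 1/12]

/-- The difference between the initial beliefs and the eventual consensus `9/20`. -/
noncomputable def shockDeviation : Fin 5 → ℝ := ![7/20, 7/20, -7/20, -7/20, -7/20]

lemma shockNetwork_pos (i j : Fin 5) : 0 < shockNetwork i j := by
  fin_cases i <;> fin_cases j <;> norm_num [shockNetwork]

lemma shockNetwork_row_sum (i : Fin 5) : ∑ j, shockNetwork i j = 1 := by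
  fin_cases i <;> norm_num [shockNetwork, Fin.sum_univ_succ]

open Matrix in
lemma shockNetwork_mulVec_const (c : ℝ) : shockNetwork *ᵥ (fun _ => c) = fun _ => c := by
  ext i
  simp [mulVec, dotProduct, ← Finset.sum_mul, shockNetwork_row_sum]

open Matrix in
lemma shockNetwork_mulVec_deviation :
    shockNetwork *ᵥ shockDeviation = (-1 / 2 : ℝ) • shockDeviation := by
  ext i
  fin_cases i <;>
    norm_num [shockNetwork, shockDeviation, mulVec, dotProduct, Fin.sum_univ_succ]

/-- A shock election can occur under DeGroot learning on a network altered by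
confirmation bias: there is a 5-agent irreducible aperiodic row-stochastic network and
initial beliefs in `[0,1]` such that society converges to a consensus strictly below
`1/2` (the Left wins in the long run), at most 2 of the 5 initial beliefs exceed `1/2`
(the Left wins at `t = 0`), yet at least 3 of the 5 beliefs at time `t = 1` exceed
`1/2` (the Right wins a majority at `t = 1`). -/
theorem shock_election_possible_with_confirmation_bias :
    ∃ (S : Matrix (Fin 5) (Fin 5) ℝ) (x₀ : Fin 5 → ℝ),
      RowStochastic S ∧ MatIrreducible S ∧ MatAperiodic S ∧
      (∀ i, x₀ i ∈ Set.Icc (0 : ℝ) 1) ∧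
      (∃ c : ℝ, c < 1 / 2 ∧
        Filter.Tendsto (fun t : ℕ => (S ^ t).mulVec x₀) Filter.atTop
          (nhds fun _ => c)) ∧
      (Finset.univ.filter (fun i => 1 / 2 < x₀ i)).card ≤ 2 ∧
      3 ≤ (Finset.univ.filter (fun i => 1 / 2 < (S.mulVec x₀) i)).card := by
  refine ⟨shockNetwork, (fun _ => 9 / 20) + shockDeviation,
    ⟨fun i j => (shockNetwork_pos i j).le, shockNetwork_row_sum⟩,
    fun i j => ⟨1, one_pos, by simpa using shockNetwork_pos i j⟩,
    ⟨1, one_pos, by simpa using shockNetwork_pos⟩, ?_,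
    ⟨9 / 20, by norm_num, tendsto_pow_mulVec_const_add (shockNetwork_mulVec_const _)
      shockNetwork_mulVec_deviation (by norm_num [abs_lt])⟩, ?_, ?_⟩
  · intro i
    fin_cases i <;> norm_num [shockDeviation]
  · refine (Finset.card_le_card (t := {0, 1}) fun i => ?_).trans Finset.card_le_two
    fin_cases i <;> norm_num [shockDeviation]
  · rw [Matrix.mulVec_add, shockNetwork_mulVec_const, shockNetwork_mulVec_deviation]
    refine (show 3 ≤ ({2, 3, 4} : Finset (Fin 5)).card by decide).trans
      (Finset.card_le_card fun i => ?_)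
    fin_cases i <;> norm_num [shockDeviation, Fin.ext_iff]
end

section
/- Let f ∈ (0,1), let Z be a positive integer, and let d_1,…,d_Z be nonnegative real numbers with average d̄ = (1/Z) Σ_{z=1}^Z d_z. Then ∏_{z=1}^Z (1 − f^{d_z}) ≤ (1 − f^{d̄})^Z, where f^d denotes the real power. Equivalently, among all allocations of a fixed total number of outgoing links across the groups, the probability 1 − ∏_z (1 − f^{d_z}) that at least one group becomes disconnected is minimized when every group has the same number of links d̄. -/
theorem prod_le_avg_pow {Z : ℕ} (hZ : 0 < Z) (x : Fin Z → ℝ) (hx : ∀ z, 0 ≤ x z) :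
    ∏ z, x z ≤ (∑ z, (1 / (Z : ℝ)) * x z) ^ Z := by
  have hZ' : (Z : ℝ) ≠ 0 := by positivity
  have amgm := Real.geom_mean_le_arith_mean_weighted Finset.univ (fun _ : Fin Z => 1 / (Z : ℝ)) x
    (fun _ _ => by positivity) (by simp [hZ']) (fun z _ => hx z)
  calc ∏ z, x z = (∏ z, x z ^ (1 / (Z : ℝ))) ^ Z := by
        rw [← Finset.prod_pow]
        refine Finset.prod_congr rfl fun z _ => ?_
        rw [one_div, Real.rpow_inv_natCast_pow (hx z) hZ.ne']
    _ ≤ _ := pow_le_pow_left₀ (Finset.prod_nonneg fun z _ => Real.rpow_nonneg (hx z) _) amgm Z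

theorem rpow_avg_le_avg_rpow {f : ℝ} (hf : 0 < f) {Z : ℕ} (hZ : 0 < Z) (d : Fin Z → ℝ) :
    f ^ ((1 / (Z : ℝ)) * ∑ z, d z) ≤ ∑ z, (1 / (Z : ℝ)) * f ^ d z := by
  have hZ' : (Z : ℝ) ≠ 0 := by positivity
  have amgm := Real.geom_mean_le_arith_mean_weighted Finset.univ (fun _ : Fin Z => 1 / (Z : ℝ))
    (fun z => f ^ d z) (fun _ _ => by positivity) (by simp [hZ']) (fun z _ => by positivity)
  convert amgm using 1
  rw [Finset.mul_sum, Real.rpow_sum_of_pos hf]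
  refine Finset.prod_congr rfl fun z _ => ?_
  rw [← Real.rpow_mul hf.le, mul_comm]

/-- Equalizing link counts minimizes the probability of a breakaway component:
for `f ∈ (0,1)` and nonnegative reals `d_1, …, d_Z` with average `d̄`,
`∏ z, (1 - f ^ (d z)) ≤ (1 - f ^ d̄) ^ Z`, where `f ^ d` is the real power. -/
theorem prod_one_sub_rpow_le_avg_pow (f : ℝ) (hf : f ∈ Set.Ioo (0 : ℝ) 1)
    (Z : ℕ) (hZ : 0 < Z) (d : Fin Z → ℝ) (hd : ∀ z, 0 ≤ d z) :
    ∏ z, (1 - f ^ (d z)) ≤ (1 - f ^ ((1 / (Z : ℝ)) * ∑ z, d z)) ^ Z := by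
  have hZ' : (Z : ℝ) ≠ 0 := by positivity
  have hx : ∀ z, 0 ≤ 1 - f ^ d z := fun z =>
    sub_nonneg.2 (Real.rpow_le_one hf.1.le hf.2.le (hd z))
  refine (prod_le_avg_pow hZ _ hx).trans (pow_le_pow_left₀
    (Finset.sum_nonneg fun z _ => mul_nonneg (by positivity) (hx z)) ?_ Z)
  have hsum : ∑ z, (1 / (Z : ℝ)) * (1 - f ^ d z) = 1 - ∑ z, (1 / (Z : ℝ)) * f ^ d z := by
    simp [mul_sub, hZ']
  rw [hsum]
  exact sub_le_sub_left (rpow_avg_le_avg_rpow hf.1 hZ d) 1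
end
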